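/- arXiv:2404.03610 — 9 statements merged into one kernel-verified Lean document; each statement's English description precedes it below -/
import Mathlib

section
/- Let a ∈ ℝ^n, write h(x) = ∑_{i=1}^n aᵢxᵢ for x ∈ {0,1}^n, and let S = {h(x) : x ∈ {0,1}^n} be the finite set of values h attains on {0,1}^n. Let b̲ ≤ b̄ with b̲, b̄ ∈ S, let T = {t ∈ S : b̲ ≤ t ≤ b̄}, and suppose k = |T| is even. Then P(x) = ∏_{t∈T} (h(x) − t) is a valid infeasible penalty for the constraint b̲ ≤ h(x) ≤ b̄: for every x ∈ {0,1}^n, P(x) = 0 if b̲ ≤ h(x) ≤ b̄, and P(x) > 0 if h(x) < b̲ or h(x) > b̄. -/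
theorem stmt_0 (n : ℕ) (a : Fin n → ℝ) (bl bu : ℝ)
    (S T : Finset ℝ)
    (hS : S = Finset.image (fun x : Fin n → Bool =>
      ∑ i, a i * (if x i then (1:ℝ) else 0)) Finset.univ)
    (hT : T = S.filter (fun t => bl ≤ t ∧ t ≤ bu))
    (hble : bl ≤ bu) (hbl : bl ∈ S) (hbu : bu ∈ S)
    (hk : Even T.card) :
    ∀ x : Fin n → Bool,
      ((bl ≤ (∑ i, a i * (if x i then (1:ℝ) else 0)) ∧
        (∑ i, a i * (if x i then (1:ℝ) else 0)) ≤ bu) →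
        (∏ t ∈ T, ((∑ i, a i * (if x i then (1:ℝ) else 0)) - t)) = 0) ∧
      (((∑ i, a i * (if x i then (1:ℝ) else 0)) < bl ∨
        bu < (∑ i, a i * (if x i then (1:ℝ) else 0))) →
        0 < ∏ t ∈ T, ((∑ i, a i * (if x i then (1:ℝ) else 0)) - t)) := by
  intro x
  have hx : (∑ i, a i * (if x i then (1:ℝ) else 0)) ∈ S := by
    rw [hS]
    exact Finset.mem_image.mpr ⟨x, Finset.mem_univ x, rfl⟩
  generalize (∑ i, a i * (if x i then (1:ℝ) else 0)) = y at hx ⊢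
  have hmem : ∀ t ∈ T, bl ≤ t ∧ t ≤ bu := by
    intro t ht
    rw [hT] at ht
    exact (Finset.mem_filter.mp ht).2
  constructor
  · intro h
    refine Finset.prod_eq_zero (i := y) ?_ (sub_self y)
    rw [hT]
    exact Finset.mem_filter.mpr ⟨hx, h⟩
  · rintro (h | h)
    · have e : ∏ t ∈ T, (y - t) = ∏ t ∈ T, (t - y) := by
        have e1 : ∏ t ∈ T, (y - t) = ∏ t ∈ T, ((-1) * (t - y)) :=
          Finset.prod_congr rfl (fun t _ => by ring)
        rw [e1, Finset.prod_mul_distrib, Finset.prod_const, hk.neg_one_pow, one_mul]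
      rw [e]
      exact Finset.prod_pos (fun t ht => by linarith [(hmem t ht).1])
    · exact Finset.prod_pos (fun t ht => by linarith [(hmem t ht).2])
end

section
/- Let a ∈ ℝ^n, write h(x) = ∑_{i=1}^n aᵢxᵢ for x ∈ {0,1}^n, and let S = {h(x) : x ∈ {0,1}^n}. Let b̲ ≤ b̄ with b̲, b̄ ∈ S, T = {t ∈ S : b̲ ≤ t ≤ b̄}, and suppose b̲ = min S (so the constraint is the one-sided upper-bound constraint h(x) ≤ b̄). Then, regardless of the parity of |T|, P(x) = ∏_{t∈T} (h(x) − t) is a valid infeasible penalty: for every x ∈ {0,1}^n, P(x) = 0 if h(x) ≤ b̄, and P(x) > 0 if h(x) > b̄. -/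
theorem stmt_2 (n : ℕ) (a : Fin n → ℝ) (bl bu : ℝ)
    (S T : Finset ℝ)
    (hS : S = Finset.image (fun x : Fin n → Bool =>
      ∑ i, a i * (if x i then (1:ℝ) else 0)) Finset.univ)
    (hT : T = S.filter (fun t => bl ≤ t ∧ t ≤ bu))
    (hble : bl ≤ bu) (hbl : bl ∈ S) (hbu : bu ∈ S)
    (hmin : ∀ t ∈ S, bl ≤ t) :
    ∀ x : Fin n → Bool,
      (((∑ i, a i * (if x i then (1:ℝ) else 0)) ≤ bu) →
        (∏ t ∈ T, ((∑ i, a i * (if x i then (1:ℝ) else 0)) - t)) = 0) ∧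
      ((bu < (∑ i, a i * (if x i then (1:ℝ) else 0))) →
        0 < ∏ t ∈ T, ((∑ i, a i * (if x i then (1:ℝ) else 0)) - t)) := by
  intro x
  have hx : (∑ i, a i * (if x i then (1:ℝ) else 0)) ∈ S := by
    rw [hS]
    exact Finset.mem_image.mpr ⟨x, Finset.mem_univ x, rfl⟩
  generalize (∑ i, a i * (if x i then (1:ℝ) else 0)) = h at hx ⊢
  refine ⟨fun hle => ?_, fun hlt => ?_⟩
  · refine Finset.prod_eq_zero (i := h) ?_ (sub_self h)
    rw [hT]
    exact Finset.mem_filter.mpr ⟨hx, hmin h hx, hle⟩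
  · refine Finset.prod_pos fun t ht => ?_
    rw [hT] at ht
    have := (Finset.mem_filter.mp ht).2.2
    linarith
end

section
/- Let a ∈ ℝ^n, write h(x) = ∑_{i=1}^n aᵢxᵢ for x ∈ {0,1}^n, and let S = {h(x) : x ∈ {0,1}^n}. Let b̲ ∈ S, let b̄ = max S, and let T = {t ∈ S : b̲ ≤ t ≤ b̄} with k = |T| (so the constraint is the one-sided lower-bound constraint h(x) ≥ b̲). Then P(x) = (−1)^k · ∏_{t∈T} (h(x) − t) is a valid infeasible penalty: for every x ∈ {0,1}^n, P(x) = 0 if h(x) ≥ b̲, and P(x) > 0 if h(x) < b̲. -/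
theorem stmt_3 (n : ℕ) (a : Fin n → ℝ) (bl bu : ℝ)
    (S T : Finset ℝ)
    (hS : S = Finset.image (fun x : Fin n → Bool =>
      ∑ i, a i * (if x i then (1:ℝ) else 0)) Finset.univ)
    (hT : T = S.filter (fun t => bl ≤ t ∧ t ≤ bu))
    (hbl : bl ∈ S) (hbu : bu ∈ S)
    (hmax : ∀ t ∈ S, t ≤ bu) :
    ∀ x : Fin n → Bool,
      ((bl ≤ (∑ i, a i * (if x i then (1:ℝ) else 0))) →
        (-1 : ℝ) ^ T.card *
          (∏ t ∈ T, ((∑ i, a i * (if x i then (1:ℝ) else 0)) - t)) = 0) ∧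
      (((∑ i, a i * (if x i then (1:ℝ) else 0)) < bl) →
        0 < (-1 : ℝ) ^ T.card *
          ∏ t ∈ T, ((∑ i, a i * (if x i then (1:ℝ) else 0)) - t)) := by
  intro x
  have hxS : (∑ i, a i * (if x i then (1:ℝ) else 0)) ∈ S := by
    rw [hS]
    exact Finset.mem_image_of_mem (fun x : Fin n → Bool =>
      ∑ i, a i * (if x i then (1:ℝ) else 0)) (Finset.mem_univ x)
  generalize (∑ i, a i * (if x i then (1:ℝ) else 0)) = h at hxS ⊢
  constructor
  · intro hb
    have hm : h ∈ T := by
      rw [hT, Finset.mem_filter]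
      exact ⟨hxS, hb, hmax _ hxS⟩
    rw [Finset.prod_eq_zero hm (sub_self h), mul_zero]
  · intro hb
    rw [← Finset.prod_const, ← Finset.prod_mul_distrib]
    apply Finset.prod_pos
    intro t ht
    rw [hT, Finset.mem_filter] at ht
    linarith [ht.2.1]
end

section
/- Let a ∈ ℝ^n, write h(x) = ∑_{i=1}^n aᵢxᵢ for x ∈ {0,1}^n, and let S = {h(x) : x ∈ {0,1}^n}. Let b̲ ≤ b̄ with b̲, b̄ ∈ S, let T = {t ∈ S : b̲ ≤ t ≤ b̄}, and suppose k = |T| is odd. Then for every t₀ ∈ T, the function P(x) = (h(x) − t₀) · ∏_{t∈T} (h(x) − t) is a valid infeasible penalty for the constraint b̲ ≤ h(x) ≤ b̄: for every x ∈ {0,1}^n, P(x) = 0 if b̲ ≤ h(x) ≤ b̄, and P(x) > 0 otherwise. -/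
theorem stmt_4 (n : ℕ) (a : Fin n → ℝ) (bl bu : ℝ)
    (S T : Finset ℝ)
    (hS : S = Finset.image (fun x : Fin n → Bool =>
      ∑ i, a i * (if x i then (1:ℝ) else 0)) Finset.univ)
    (hT : T = S.filter (fun t => bl ≤ t ∧ t ≤ bu))
    (hble : bl ≤ bu) (hbl : bl ∈ S) (hbu : bu ∈ S)
    (hk : Odd T.card) (t0 : ℝ) (ht0 : t0 ∈ T) :
    ∀ x : Fin n → Bool,
      ((bl ≤ (∑ i, a i * (if x i then (1:ℝ) else 0)) ∧
        (∑ i, a i * (if x i then (1:ℝ) else 0)) ≤ bu) →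
        ((∑ i, a i * (if x i then (1:ℝ) else 0)) - t0) *
          (∏ t ∈ T, ((∑ i, a i * (if x i then (1:ℝ) else 0)) - t)) = 0) ∧
      (¬ (bl ≤ (∑ i, a i * (if x i then (1:ℝ) else 0)) ∧
          (∑ i, a i * (if x i then (1:ℝ) else 0)) ≤ bu) →
        0 < ((∑ i, a i * (if x i then (1:ℝ) else 0)) - t0) *
          ∏ t ∈ T, ((∑ i, a i * (if x i then (1:ℝ) else 0)) - t)) := by
  intro x
  have hmem : (∑ i, a i * (if x i then (1:ℝ) else 0)) ∈ S := by
    rw [hS]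
    exact Finset.mem_image_of_mem
      (fun x : Fin n → Bool => ∑ i, a i * (if x i then (1:ℝ) else 0)) (Finset.mem_univ x)
  generalize (∑ i, a i * (if x i then (1:ℝ) else 0)) = h at hmem ⊢
  have hb : ∀ t ∈ T, bl ≤ t ∧ t ≤ bu := by
    intro t ht
    rw [hT] at ht
    exact (Finset.mem_filter.mp ht).2
  constructor
  · intro hh
    have hhT : h ∈ T := by
      rw [hT]
      exact Finset.mem_filter.mpr ⟨hmem, hh⟩
    rw [Finset.prod_eq_zero hhT (sub_self h), mul_zero]
  · intro hh
    by_cases h1 : bl ≤ h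
    · have h2 : bu < h := by
        by_contra h3
        exact hh ⟨h1, not_lt.mp h3⟩
      apply mul_pos
      · linarith [(hb t0 ht0).2]
      · apply Finset.prod_pos
        intro t ht
        linarith [(hb t ht).2]
    · have h2 : h < bl := not_le.mp h1
      have e : ∏ t ∈ T, (h - t) = - ∏ t ∈ T, (t - h) := by
        have : ∏ t ∈ T, (h - t) = ∏ t ∈ T, ((-1) * (t - h)) :=
          Finset.prod_congr rfl (fun t _ => by ring)
        rw [this, Finset.prod_mul_distrib, Finset.prod_const, hk.neg_one_pow]
        ring
      rw [e]
      apply mul_pos_of_neg_of_neg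
      · linarith [(hb t0 ht0).1]
      · apply neg_neg_of_pos
        apply Finset.prod_pos
        intro t ht
        linarith [(hb t ht).1]
end

section
/- Consider the binary linear program min a₀ᵀx over x ∈ {0,1}^n subject to Ax = b and, for i = 1,…,m', b̲ᵢ ≤ aᵢᵀx ≤ b̄ᵢ, where A ∈ ℝ^{m×n}, b ∈ ℝ^m, aᵢ ∈ ℝ^n, b̲ᵢ ≤ b̄ᵢ ∈ ℝ; assume the feasible set E is nonempty. For each inequality constraint i, let Iᵢ = {l : (aᵢ)ₗ ≠ 0} and let kᵢ = |{t ∈ {aᵢᵀx : x ∈ {0,1}^n} : b̲ᵢ ≤ t ≤ b̄ᵢ}| be its levelness. If for every i = 1,…,m' we have kᵢ ≤ 2 or |Iᵢ| ≤ 2, then there exists a polynomial F : ℝ^n → ℝ of total degree at most 2 such that min_{x∈{0,1}^n} F(x) = min_{x∈E} a₀ᵀx and the minimizers of F over {0,1}^n are exactly the optimal solutions of the binary linear program. -/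
/-- The real vector corresponding to a binary vector `x ∈ {0,1}ⁿ`. -/
def binVal {n : ℕ} (x : Fin n → Bool) : Fin n → ℝ := fun i => if x i then 1 else 0

/-- Feasibility for the BLP: `Ax = b` and `b̲ᵢ ≤ aᵢᵀx ≤ b̄ᵢ` for all `i`. -/
def blpFeasible {n m m' : ℕ} (A : Fin m → Fin n → ℝ) (b : Fin m → ℝ)
    (a : Fin m' → Fin n → ℝ) (bl bu : Fin m' → ℝ) (x : Fin n → Bool) : Prop :=
  (∀ j, ∑ l, A j l * binVal x l = b j) ∧
  (∀ i, bl i ≤ ∑ l, a i l * binVal x l ∧ (∑ l, a i l * binVal x l) ≤ bu i)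

open MvPolynomial in
noncomputable def linP {n : ℕ} (c : Fin n → ℝ) : MvPolynomial (Fin n) ℝ := ∑ l, C (c l) * X l

theorem eval_linP {n : ℕ} (c v : Fin n → ℝ) :
    MvPolynomial.eval v (linP c) = ∑ l, c l * v l := by
  simp [linP]

open MvPolynomial in
theorem deg_mulC {n : ℕ} (r : ℝ) (p : MvPolynomial (Fin n) ℝ) {d : ℕ}
    (h : p.totalDegree ≤ d) : (C r * p).totalDegree ≤ d := by
  refine (totalDegree_mul _ _).trans ?_
  simpa using h

open MvPolynomial in
theorem deg_linP {n : ℕ} (c : Fin n → ℝ) : (linP c).totalDegree ≤ 1 := by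
  refine totalDegree_finsetSum_le fun l _ => deg_mulC _ _ (by simp)

open MvPolynomial in
theorem deg_subC {n : ℕ} (r : ℝ) (p : MvPolynomial (Fin n) ℝ) {d : ℕ}
    (h : p.totalDegree ≤ d) : (p - C r).totalDegree ≤ d := by
  refine (totalDegree_sub _ _).trans ?_
  simpa using h

open MvPolynomial in
theorem deg_Csub {n : ℕ} (r : ℝ) (p : MvPolynomial (Fin n) ℝ) {d : ℕ}
    (h : p.totalDegree ≤ d) : (C r - p).totalDegree ≤ d := by
  refine (totalDegree_sub _ _).trans ?_
  simpa using h

theorem deg_mul2 {n : ℕ} (p q : MvPolynomial (Fin n) ℝ)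
    (h : p.totalDegree ≤ 1) (h' : q.totalDegree ≤ 1) : (p * q).totalDegree ≤ 2 :=
  (MvPolynomial.totalDegree_mul _ _).trans (by omega)

theorem deg_add2 {n : ℕ} (p q : MvPolynomial (Fin n) ℝ) {d : ℕ}
    (h : p.totalDegree ≤ d) (h' : q.totalDegree ≤ d) : (p + q).totalDegree ≤ d :=
  (MvPolynomial.totalDegree_add _ _).trans (max_le h h')

/-- a penalty from two levels -/
theorem pen_level {n : ℕ} (c : Fin n → ℝ) (l u t1 t2 : ℝ)
    (h1 : l ≤ t1 ∧ t1 ≤ u) (h2 : l ≤ t2 ∧ t2 ≤ u)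
    (hS : ∀ x : Fin n → Bool, l ≤ ∑ k, c k * binVal x k → ∑ k, c k * binVal x k ≤ u →
      ∑ k, c k * binVal x k = t1 ∨ ∑ k, c k * binVal x k = t2) :
    ∃ P : MvPolynomial (Fin n) ℝ, P.totalDegree ≤ 2 ∧ ∀ x : Fin n → Bool,
      0 ≤ MvPolynomial.eval (binVal x) P ∧ (MvPolynomial.eval (binVal x) P = 0 ↔
        l ≤ ∑ k, c k * binVal x k ∧ ∑ k, c k * binVal x k ≤ u) := by
  refine ⟨(linP c - MvPolynomial.C t1) * (linP c - MvPolynomial.C t2),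
    deg_mul2 _ _ (deg_subC _ _ (deg_linP c)) (deg_subC _ _ (deg_linP c)), fun x => ?_⟩
  have := hS x
  simp only [map_mul, map_sub, eval_linP, MvPolynomial.eval_C]
  generalize ∑ k, c k * binVal x k = t at *
  by_cases hl : l ≤ t
  · by_cases hu : t ≤ u
    · have h := this hl hu
      have : (t - t1) * (t - t2) = 0 := by rcases h with h | h <;> simp [h]
      simp [this, hl, hu]
    · have : 0 < (t - t1) * (t - t2) := mul_pos (by linarith) (by linarith)
      exact ⟨this.le, fun h => absurd h this.ne', fun h => absurd h.2 hu⟩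
  · have : 0 < (t - t1) * (t - t2) := mul_pos_of_neg_of_neg (by linarith) (by linarith)
    exact ⟨this.le, fun h => absurd h this.ne', fun h => absurd h.1 hl⟩

open MvPolynomial in
/-- a penalty from two variables -/
theorem pen_pair {n : ℕ} (p q : Fin n) (S : (Fin n → Bool) → Prop)
    (hS : ∀ x y : Fin n → Bool, x p = y p → x q = y q → S x → S y) :
    ∃ P : MvPolynomial (Fin n) ℝ, P.totalDegree ≤ 2 ∧ ∀ x : Fin n → Bool,
      0 ≤ MvPolynomial.eval (binVal x) P ∧ (MvPolynomial.eval (binVal x) P = 0 ↔ S x) := by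
  classical
  let g : Bool → Bool → ℝ := fun u v => if ∃ x : Fin n → Bool, x p = u ∧ x q = v ∧ ¬ S x then 1 else 0
  have hX : ∀ i : Fin n, (X i : MvPolynomial (Fin n) ℝ).totalDegree ≤ 1 := fun i => by simp
  have hY : ∀ i : Fin n, (C 1 - X i : MvPolynomial (Fin n) ℝ).totalDegree ≤ 1 :=
    fun i => deg_Csub _ _ (hX i)
  refine ⟨C (g true true) * (X p * X q) + C (g true false) * (X p * (C 1 - X q))
    + C (g false true) * ((C 1 - X p) * X q) + C (g false false) * ((C 1 - X p) * (C 1 - X q)),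
    ?_, fun x => ?_⟩
  · exact deg_add2 _ _ (deg_add2 _ _ (deg_add2 _ _ (deg_mulC _ _ (deg_mul2 _ _ (hX _) (hX _)))
      (deg_mulC _ _ (deg_mul2 _ _ (hX _) (hY _)))) (deg_mulC _ _ (deg_mul2 _ _ (hY _) (hX _))))
      (deg_mulC _ _ (deg_mul2 _ _ (hY _) (hY _)))
  · have key : g (x p) (x q) = if S x then 0 else 1 := by
      by_cases h : S x
      · have : ¬ ∃ y : Fin n → Bool, y p = x p ∧ y q = x q ∧ ¬ S y := by
          rintro ⟨y, h1, h2, h3⟩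
          exact h3 (hS x y h1.symm h2.symm h)
        simp [g, this, h]
      · have : ∃ y : Fin n → Bool, y p = x p ∧ y q = x q ∧ ¬ S y := ⟨x, rfl, rfl, h⟩
        simp only [g, if_pos this, if_neg h]
    have key2 : ∀ P : ℝ, P = g (x p) (x q) → 0 ≤ P ∧ (P = 0 ↔ S x) := by
      rintro P rfl
      rw [key]
      by_cases h : S x <;> simp [h]
    apply key2
    simp only [map_add, map_mul, map_sub, eval_C, eval_X, binVal]
    cases x p <;> cases x q <;> simp

theorem pen_ineq {n : ℕ} (c : Fin n → ℝ) (l u : ℝ)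
    (hE : ∃ x : Fin n → Bool, l ≤ ∑ k, c k * binVal x k ∧ ∑ k, c k * binVal x k ≤ u)
    (hc : ({t : ℝ | (∃ x : Fin n → Bool, t = ∑ k, c k * binVal x k) ∧
          l ≤ t ∧ t ≤ u}.ncard ≤ 2) ∨ ({k : Fin n | c k ≠ 0}.ncard ≤ 2)) :
    ∃ P : MvPolynomial (Fin n) ℝ, P.totalDegree ≤ 2 ∧ ∀ x : Fin n → Bool,
      0 ≤ MvPolynomial.eval (binVal x) P ∧ (MvPolynomial.eval (binVal x) P = 0 ↔
        l ≤ ∑ k, c k * binVal x k ∧ ∑ k, c k * binVal x k ≤ u) := by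
  have pair : ∀ {α : Type} (s : Set α), s.Finite → s.Nonempty → s.ncard ≤ 2 →
      ∃ p ∈ s, ∃ q ∈ s, ∀ z ∈ s, z = p ∨ z = q := by
    intro α s hf hn h2
    have h0 : 0 < s.ncard := (Set.ncard_pos hf).2 hn
    have : s.ncard = 1 ∨ s.ncard = 2 := by omega
    rcases this with h | h
    · obtain ⟨p, rfl⟩ := Set.ncard_eq_one.1 h
      exact ⟨p, by simp, p, by simp, by simp⟩
    · obtain ⟨p, q, _, rfl⟩ := Set.ncard_eq_two.1 h
      exact ⟨p, by simp, q, by simp, by simp⟩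
  rcases hc with hc | hc
  · obtain ⟨x0, hx0⟩ := hE
    obtain ⟨t1, h1, t2, h2, h⟩ := pair {t : ℝ | (∃ x : Fin n → Bool, t = ∑ k, c k * binVal x k) ∧
          l ≤ t ∧ t ≤ u} ((Set.finite_range
      (fun x : Fin n → Bool => ∑ k, c k * binVal x k)).subset (by
        rintro t ⟨⟨x, rfl⟩, _⟩; exact ⟨x, rfl⟩)) ⟨_, ⟨x0, rfl⟩, hx0⟩ hc
    exact pen_level c l u t1 t2 h1.2 h2.2 fun x ha hb => h _ ⟨⟨x, rfl⟩, ha, hb⟩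
  · rcases Set.eq_empty_or_nonempty {k : Fin n | c k ≠ 0} with h | h
    · have h0 : ∀ k, c k = 0 := fun k => by
        by_contra hk
        have : k ∈ {k : Fin n | c k ≠ 0} := hk
        simp [h] at this
      refine ⟨0, by simp, fun x => ?_⟩
      simpa [h0] using hE
    · obtain ⟨p, _, q, _, h⟩ := pair _ (Set.toFinite _) h hc
      refine pen_pair p q _ fun x y hp hq hx => ?_
      have : ∑ k, c k * binVal x k = ∑ k, c k * binVal y k := by
        refine Finset.sum_congr rfl fun k _ => ?_
        by_cases hk : c k = 0
        · simp [hk]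
        · rcases h k hk with rfl | rfl <;> simp [binVal, hp, hq]
      rwa [← this]

theorem stmt_6 (n m m' : ℕ) (a0 : Fin n → ℝ)
    (A : Fin m → Fin n → ℝ) (b : Fin m → ℝ)
    (a : Fin m' → Fin n → ℝ) (bl bu : Fin m' → ℝ)
    (hb : ∀ i, bl i ≤ bu i)
    (hE : ∃ x : Fin n → Bool, blpFeasible A b a bl bu x)
    (hcond : ∀ i : Fin m',
      ({t : ℝ | (∃ x : Fin n → Bool, t = ∑ l, a i l * binVal x l) ∧
          bl i ≤ t ∧ t ≤ bu i}.ncard ≤ 2) ∨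
      ({l : Fin n | a i l ≠ 0}.ncard ≤ 2)) :
    ∃ F : MvPolynomial (Fin n) ℝ, F.totalDegree ≤ 2 ∧
      (∀ x : Fin n → Bool,
        (∀ y : Fin n → Bool,
            MvPolynomial.eval (binVal x) F ≤ MvPolynomial.eval (binVal y) F) ↔
        (blpFeasible A b a bl bu x ∧
          ∀ y : Fin n → Bool, blpFeasible A b a bl bu y →
            (∑ l, a0 l * binVal x l) ≤ ∑ l, a0 l * binVal y l)) ∧
      (∀ x : Fin n → Bool,
        (∀ y : Fin n → Bool,
            MvPolynomial.eval (binVal x) F ≤ MvPolynomial.eval (binVal y) F) →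
        MvPolynomial.eval (binVal x) F = ∑ l, a0 l * binVal x l) := by
  classical
  have hP := fun i => pen_ineq (a i) (bl i) (bu i) (hE.imp fun x hx => hx.2 i) (hcond i)
  choose P hPd hPx using hP
  let Q : MvPolynomial (Fin n) ℝ :=
    ∑ j, (linP (A j) - MvPolynomial.C (b j)) * (linP (A j) - MvPolynomial.C (b j)) + ∑ i, P i
  have hQd : Q.totalDegree ≤ 2 := by
    refine deg_add2 _ _ (MvPolynomial.totalDegree_finsetSum_le fun j _ => ?_)
      (MvPolynomial.totalDegree_finsetSum_le fun i _ => hPd i)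
    exact deg_mul2 _ _ (deg_subC _ _ (deg_linP _)) (deg_subC _ _ (deg_linP _))
  obtain ⟨q, hq⟩ : ∃ q : (Fin n → Bool) → ℝ, q = fun x => MvPolynomial.eval (binVal x) Q := ⟨_, rfl⟩
  have hqe : ∀ x, q x = ∑ j, (∑ l, A j l * binVal x l - b j) * (∑ l, A j l * binVal x l - b j)
      + ∑ i, MvPolynomial.eval (binVal x) (P i) := by
    intro x
    simp only [hq, Q, map_add, map_sum, map_mul, map_sub, eval_linP, MvPolynomial.eval_C]
  have hs1 : ∀ x : Fin n → Bool,
      0 ≤ ∑ j, (∑ l, A j l * binVal x l - b j) * (∑ l, A j l * binVal x l - b j) :=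
    fun x => Finset.sum_nonneg fun j _ => mul_self_nonneg _
  have hs2 : ∀ x : Fin n → Bool, 0 ≤ ∑ i, MvPolynomial.eval (binVal x) (P i) :=
    fun x => Finset.sum_nonneg fun i _ => (hPx i x).1
  have hq0 : ∀ x, 0 ≤ q x := fun x => by rw [hqe]; exact add_nonneg (hs1 x) (hs2 x)
  have hqf : ∀ x, q x = 0 ↔ blpFeasible A b a bl bu x := by
    intro x
    rw [hqe, add_eq_zero_iff_of_nonneg (hs1 x) (hs2 x),
      Finset.sum_eq_zero_iff_of_nonneg (fun j _ => mul_self_nonneg _),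
      Finset.sum_eq_zero_iff_of_nonneg (fun i _ => (hPx i x).1)]
    simp only [Finset.mem_univ, true_imp_iff, mul_self_eq_zero, sub_eq_zero, blpFeasible]
    exact and_congr Iff.rfl (forall_congr' fun i => (hPx i x).2)
  obtain ⟨f, hf⟩ : ∃ f : (Fin n → Bool) → ℝ, f = fun x => ∑ l, a0 l * binVal x l := ⟨_, rfl⟩
  obtain ⟨xs, hxs, hmin⟩ : ∃ xs, blpFeasible A b a bl bu xs ∧
      ∀ y, blpFeasible A b a bl bu y → f xs ≤ f y :=
    Set.exists_min_image {x | blpFeasible A b a bl bu x} f (Set.toFinite _) hE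
  let lam : ℝ := 1 + ∑ x, |f xs - f x| / q x
  have hterm : ∀ x, 0 ≤ |f xs - f x| / q x := fun x => div_nonneg (abs_nonneg _) (hq0 x)
  have hbig : ∀ x, ¬ blpFeasible A b a bl bu x → f xs < f x + lam * q x := by
    intro x hx
    have hpos : 0 < q x := lt_of_le_of_ne (hq0 x) fun h => hx ((hqf x).1 h.symm)
    have h1 : |f xs - f x| / q x ≤ ∑ x, |f xs - f x| / q x :=
      Finset.single_le_sum (f := fun x => |f xs - f x| / q x) (fun y _ => hterm y)
        (Finset.mem_univ x)
    have h2 : (1 + |f xs - f x| / q x) * q x ≤ lam * q x :=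
      mul_le_mul_of_nonneg_right (by simp only [lam]; linarith) hpos.le
    have h3 : (1 + |f xs - f x| / q x) * q x = q x + |f xs - f x| := by
      field_simp
    have := le_abs_self (f xs - f x)
    linarith
  have hFe : ∀ x : Fin n → Bool, MvPolynomial.eval (binVal x) (linP a0 + MvPolynomial.C lam * Q)
      = f x + lam * q x := by
    intro x
    simp only [hf, hq, map_add, map_mul, eval_linP, MvPolynomial.eval_C]
  have hfe : ∀ x, ∑ l, a0 l * binVal x l = f x := fun x => by rw [hf]
  have hfeas : ∀ x, blpFeasible A b a bl bu x → f x + lam * q x = f x := fun x hx => by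
    rw [(hqf x).2 hx]; ring
  have hfwd : ∀ x, (∀ y, f x + lam * q x ≤ f y + lam * q y) → blpFeasible A b a bl bu x := by
    intro x h
    by_contra hx
    have h1 := hbig x hx
    have h2 := h xs
    rw [hfeas xs hxs] at h2
    linarith
  refine ⟨linP a0 + MvPolynomial.C lam * Q,
    deg_add2 _ _ ((deg_linP a0).trans (by norm_num)) (deg_mulC _ _ hQd), ?_, ?_⟩
  · intro x
    simp only [hFe, hfe]
    constructor
    · intro h
      have hx := hfwd x h
      refine ⟨hx, fun y hy => ?_⟩
      have := h y
      rwa [hfeas x hx, hfeas y hy] at this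
    · rintro ⟨hx, h⟩ y
      rw [hfeas x hx]
      by_cases hy : blpFeasible A b a bl bu y
      · rw [hfeas y hy]; exact h y hy
      · exact (h xs hxs).trans (hbig y hy).le
  · intro x h
    simp only [hFe, hfe] at h ⊢
    exact hfeas x (hfwd x h)
end

section
/- Consider the binary linear program min a₀ᵀx over x ∈ {0,1}^n subject to Ax = b and, for i = 1,…,m', b̲ᵢ ≤ aᵢᵀx ≤ b̄ᵢ, with nonempty feasible set E. If every inequality constraint has levelness at most two, i.e. for every i, |{t ∈ {aᵢᵀx : x ∈ {0,1}^n} : b̲ᵢ ≤ t ≤ b̄ᵢ}| ≤ 2, then there exists a polynomial F : ℝ^n → ℝ of total degree at most 2 such that min_{x∈{0,1}^n} F(x) = min_{x∈E} a₀ᵀx and the minimizers of F over {0,1}^n are exactly the optimal solutions of the binary linear program. -/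
open MvPolynomial in
lemma lin_deg {n : ℕ} (c : Fin n → ℝ) (d : ℝ) :
    ((∑ l, C (c l) * X l - C d : MvPolynomial (Fin n) ℝ)).totalDegree ≤ 1 := by
  refine (totalDegree_sub _ _).trans (max_le ?_ (by simp))
  refine totalDegree_finsetSum_le fun l _ => ?_
  refine (totalDegree_mul _ _).trans ?_
  simp

lemma level_pair {ι : Type*} [Finite ι] (s : ι → ℝ) (l u : ℝ)
    (hne : ∃ x, l ≤ s x ∧ s x ≤ u)
    (hc : {t : ℝ | (∃ x, t = s x) ∧ l ≤ t ∧ t ≤ u}.ncard ≤ 2) :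
    ∃ p q : ℝ, ∀ x, 0 ≤ (s x - p) * (s x - q) ∧
      ((s x - p) * (s x - q) = 0 ↔ l ≤ s x ∧ s x ≤ u) := by
  set S := {t : ℝ | (∃ x, t = s x) ∧ l ≤ t ∧ t ≤ u} with hS
  have hfin : S.Finite := (Set.finite_range s).subset (by
    rintro t ⟨⟨x, rfl⟩, _⟩
    exact ⟨x, rfl⟩)
  obtain ⟨x0, hx0⟩ := hne
  have hx0S : s x0 ∈ S := ⟨⟨x0, rfl⟩, hx0⟩
  have key : ∃ p q, S = {p, q} := by
    have hpos : 0 < S.ncard := (Set.ncard_pos hfin).2 ⟨_, hx0S⟩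
    have h12 : S.ncard = 1 ∨ S.ncard = 2 := by omega
    rcases h12 with h | h
    · obtain ⟨p, hp⟩ := Set.ncard_eq_one.1 h
      exact ⟨p, p, by simp [hp]⟩
    · obtain ⟨p, q, _, hp⟩ := Set.ncard_eq_two.1 h
      exact ⟨p, q, hp⟩
  obtain ⟨p, q, hpq⟩ := key
  have hp : p ∈ S := by simp [hpq]
  have hq : q ∈ S := by simp [hpq]
  obtain ⟨_, hp1, hp2⟩ := hp
  obtain ⟨_, hq1, hq2⟩ := hq
  refine ⟨p, q, fun x => ?_⟩
  by_cases hx : l ≤ s x ∧ s x ≤ u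
  · have hm : s x ∈ S := ⟨⟨x, rfl⟩, hx⟩
    have h0 : (s x - p) * (s x - q) = 0 := by
      rw [hpq] at hm
      rcases hm with h | h
      · rw [h]; ring
      · rw [Set.mem_singleton_iff.1 h]; ring
    exact ⟨h0.ge, fun _ => hx, fun _ => h0⟩
  · have h0 : 0 < (s x - p) * (s x - q) := by
      by_cases h1 : l ≤ s x
      · have h2 : u < s x := not_le.1 fun h => hx ⟨h1, h⟩
        exact mul_pos (by linarith) (by linarith)
      · push Not at h1
        exact mul_pos_of_neg_of_neg (by linarith) (by linarith)
    exact ⟨h0.le, fun h => absurd h h0.ne', fun h => absurd h hx⟩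

lemma penalty {ι : Type*} [Finite ι] (f P : ι → ℝ) (E : ι → Prop) (hE : ∃ x, E x)
    (hP : ∀ x, 0 ≤ P x) (hPE : ∀ x, P x = 0 ↔ E x) :
    ∃ k : ℝ, (∀ x, (∀ y, f x + k * P x ≤ f y + k * P y) ↔
        (E x ∧ ∀ y, E y → f x ≤ f y)) ∧
      (∀ x, (∀ y, f x + k * P x ≤ f y + k * P y) → f x + k * P x = f x) := by
  obtain ⟨z, hzE, hz⟩ := Set.exists_min_image {x | E x} f (Set.toFinite _) hE
  obtain ⟨K, hK⟩ := (Set.finite_range fun x => (f z - f x) / P x).bddAbove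
  have hk : ∀ x, ¬ E x → f z < f x + (K + 1) * P x := by
    intro x hx
    have hpos : 0 < P x := lt_of_le_of_ne (hP x) fun h => hx ((hPE x).1 h.symm)
    have h1 : (f z - f x) / P x < K + 1 := by
      have := hK ⟨x, rfl⟩
      simp only at this
      linarith
    rw [div_lt_iff₀ hpos] at h1
    linarith
  have hEv : ∀ x, E x → f x + (K + 1) * P x = f x := by
    intro x hx
    rw [(hPE x).2 hx]; ring
  have hmin : ∀ x, (∀ y, f x + (K + 1) * P x ≤ f y + (K + 1) * P y) → E x := by
    intro x h
    by_contra hx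
    have h1 := hk x hx
    have h2 := h z
    rw [hEv z hzE] at h2
    linarith
  refine ⟨K + 1, fun x => ⟨fun h => ⟨hmin x h, fun y hy => ?_⟩, ?_⟩,
    fun x h => hEv x (hmin x h)⟩
  · have := h y
    rwa [hEv y hy, hEv x (hmin x h)] at this
  · rintro ⟨hx, h⟩ y
    rw [hEv x hx]
    by_cases hy : E y
    · rw [hEv y hy]; exact h y hy
    · exact (h z hzE).trans (hk y hy).le

theorem stmt_7 (n m m' : ℕ) (a0 : Fin n → ℝ)
    (A : Fin m → Fin n → ℝ) (b : Fin m → ℝ)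
    (a : Fin m' → Fin n → ℝ) (bl bu : Fin m' → ℝ)
    (hb : ∀ i, bl i ≤ bu i)
    (hE : ∃ x : Fin n → Bool, blpFeasible A b a bl bu x)
    (hcond : ∀ i : Fin m',
      {t : ℝ | (∃ x : Fin n → Bool, t = ∑ l, a i l * binVal x l) ∧
          bl i ≤ t ∧ t ≤ bu i}.ncard ≤ 2) :
    ∃ F : MvPolynomial (Fin n) ℝ, F.totalDegree ≤ 2 ∧
      (∀ x : Fin n → Bool,
        (∀ y : Fin n → Bool,
            MvPolynomial.eval (binVal x) F ≤ MvPolynomial.eval (binVal y) F) ↔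
        (blpFeasible A b a bl bu x ∧
          ∀ y : Fin n → Bool, blpFeasible A b a bl bu y →
            (∑ l, a0 l * binVal x l) ≤ ∑ l, a0 l * binVal y l)) ∧
      (∀ x : Fin n → Bool,
        (∀ y : Fin n → Bool,
            MvPolynomial.eval (binVal x) F ≤ MvPolynomial.eval (binVal y) F) →
        MvPolynomial.eval (binVal x) F = ∑ l, a0 l * binVal x l) := by
  obtain ⟨x0, hx0⟩ := hE
  have hpq := fun i => level_pair (fun x : Fin n → Bool => ∑ l, a i l * binVal x l) (bl i) (bu i)
    ⟨x0, hx0.2 i⟩ (hcond i)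
  choose p q hpq using hpq
  let L : (Fin n → ℝ) → ℝ → MvPolynomial (Fin n) ℝ := fun c d =>
    ∑ l, MvPolynomial.C (c l) * MvPolynomial.X l - MvPolynomial.C d
  have hL : ∀ c d x, MvPolynomial.eval x (L c d) = ∑ l, c l * x l - d := by
    intro c d x
    simp [L]
  have hLd : ∀ c d, (L c d).totalDegree ≤ 1 := fun c d => lin_deg c d
  have hLL : ∀ c d c' d', (L c d * L c' d').totalDegree ≤ 2 := fun c d c' d' =>
    (MvPolynomial.totalDegree_mul _ _).trans (add_le_add (hLd c d) (hLd c' d'))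
  let Q : MvPolynomial (Fin n) ℝ :=
    ∑ j, L (A j) (b j) * L (A j) (b j) + ∑ i, L (a i) (p i) * L (a i) (q i)
  have hQd : Q.totalDegree ≤ 2 :=
    (MvPolynomial.totalDegree_add _ _).trans (max_le
      (MvPolynomial.totalDegree_finsetSum_le fun j _ => hLL _ _ _ _)
      (MvPolynomial.totalDegree_finsetSum_le fun j _ => hLL _ _ _ _))
  have hQ : ∀ x, MvPolynomial.eval x Q =
      ∑ j, (∑ l, A j l * x l - b j) * (∑ l, A j l * x l - b j) +
      ∑ i, (∑ l, a i l * x l - p i) * (∑ l, a i l * x l - q i) := by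
    intro x
    simp only [Q, map_add, map_sum, map_mul, hL]
  have h1 : ∀ x : Fin n → Bool, 0 ≤ ∑ j, (∑ l, A j l * binVal x l - b j) *
      (∑ l, A j l * binVal x l - b j) := fun x => Finset.sum_nonneg fun j _ => mul_self_nonneg _
  have h2 : ∀ x : Fin n → Bool, 0 ≤ ∑ i, (∑ l, a i l * binVal x l - p i) *
      (∑ l, a i l * binVal x l - q i) := fun x => Finset.sum_nonneg fun i _ => (hpq i x).1
  obtain ⟨k, hk1, hk2⟩ := penalty (fun x : Fin n → Bool => ∑ l, a0 l * binVal x l)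
    (fun x => MvPolynomial.eval (binVal x) Q) (blpFeasible A b a bl bu) ⟨x0, hx0⟩
    (fun x => by
      simp only [hQ]
      exact add_nonneg (h1 x) (h2 x))
    (fun x => by
      simp only [hQ]
      rw [add_eq_zero_iff_of_nonneg (h1 x) (h2 x),
        Finset.sum_eq_zero_iff_of_nonneg (fun j _ => mul_self_nonneg _),
        Finset.sum_eq_zero_iff_of_nonneg (fun i _ => (hpq i x).1)]
      unfold blpFeasible
      refine and_congr ?_ ?_
      · simp [sub_eq_zero]
      · simp only [Finset.mem_univ, true_imp_iff]
        exact forall_congr' fun i => (hpq i x).2)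
  have hF : ∀ x, MvPolynomial.eval x (L a0 0 + MvPolynomial.C k * Q) =
      ∑ l, a0 l * x l + k * MvPolynomial.eval x Q := by
    intro x
    simp [hL]
  refine ⟨L a0 0 + MvPolynomial.C k * Q, ?_, ?_, ?_⟩
  · refine (MvPolynomial.totalDegree_add _ _).trans (max_le ((hLd _ _).trans one_le_two) ?_)
    refine (MvPolynomial.totalDegree_mul _ _).trans ?_
    simpa using hQd
  · simp only [hF]
    exact hk1
  · simp only [hF]
    exact hk2
end

section
/- Consider the binary linear program min a₀ᵀx over x ∈ {0,1}^n subject to Ax = b and, for i = 1,…,m', b̲ᵢ ≤ aᵢᵀx ≤ b̄ᵢ, with nonempty feasible set E. If every inequality constraint involves at most two variables, i.e. for every i the set Iᵢ = {l : (aᵢ)ₗ ≠ 0} has |Iᵢ| ≤ 2, then there exists a polynomial F : ℝ^n → ℝ of total degree at most 2 such that min_{x∈{0,1}^n} F(x) = min_{x∈E} a₀ᵀx and the minimizers of F over {0,1}^n are exactly the optimal solutions of the binary linear program. -/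
open MvPolynomial in
lemma two_var_poly {n : ℕ} (s : Set (Fin n)) (hs : s.ncard ≤ 2) (g : (Fin n → Bool) → ℝ)
    (hg : ∀ x y : Fin n → Bool, (∀ l ∈ s, x l = y l) → g x = g y) :
    ∃ P : MvPolynomial (Fin n) ℝ, P.totalDegree ≤ 2 ∧ ∀ x, eval (binVal x) P = g x := by
  have hjk : s = ∅ ∨ ∃ j k, s ⊆ {j, k} := by
    have h3 : s.ncard = 0 ∨ s.ncard = 1 ∨ s.ncard = 2 := by omega
    rcases h3 with h | h | h
    · left; exact (Set.ncard_eq_zero (Set.toFinite s)).1 h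
    · obtain ⟨j, rfl⟩ := Set.ncard_eq_one.1 h
      right; exact ⟨j, j, by simp⟩
    · obtain ⟨j, k, _, rfl⟩ := Set.ncard_eq_two.1 h
      right; exact ⟨j, k, subset_rfl⟩
  rcases hjk with rfl | ⟨j, k, hsub⟩
  · exact ⟨C (g fun _ => false), by simp, fun x => by
      rw [eval_C]; exact hg _ _ (by simp)⟩
  · let w : Bool → Bool → (Fin n → Bool) := fun p q l => if l = j then p else q
    have hw : ∀ x : Fin n → Bool, g (w (x j) (x k)) = g x := by
      intro x
      apply hg
      intro l hl
      rcases hsub hl with rfl | h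
      · simp [w]
      · have : l = k := h
        subst this
        by_cases h : l = j <;> simp [w, h]
    let L : Bool → Fin n → MvPolynomial (Fin n) ℝ := fun p l => if p then X l else 1 - X l
    have hL : ∀ p l, (L p l).totalDegree ≤ 1 := by
      intro p l
      cases p
      · simp only [L]
        refine (totalDegree_sub _ _).trans ?_
        simp
      · simp [L]
    refine ⟨∑ p : Bool, ∑ q : Bool, C (g (w p q)) * (L p j * L q k), ?_, ?_⟩
    · refine totalDegree_finsetSum_le fun p _ => totalDegree_finsetSum_le fun q _ => ?_
      refine (totalDegree_mul _ _).trans ?_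
      have h1 := totalDegree_mul (L p j) (L q k)
      have h2 := hL p j
      have h3 := hL q k
      rw [totalDegree_C]
      omega
    · intro x
      rw [← hw x]
      cases hj : x j <;> cases hk : x k <;> simp [L, binVal, hj, hk]

open MvPolynomial in
lemma lin_poly {n : ℕ} (c : Fin n → ℝ) :
    ∃ P : MvPolynomial (Fin n) ℝ, P.totalDegree ≤ 1 ∧
      ∀ x : Fin n → Bool, eval (binVal x) P = ∑ l, c l * binVal x l := by
  refine ⟨∑ l, C (c l) * X l, ?_, ?_⟩
  · refine totalDegree_finsetSum_le fun l _ => (totalDegree_mul _ _).trans ?_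
    simp
  · intro x; simp

open MvPolynomial in
lemma penalty_poly {n m m' : ℕ} 
    (A : Fin m → Fin n → ℝ) (b : Fin m → ℝ)
    (a : Fin m' → Fin n → ℝ) (bl bu : Fin m' → ℝ)
    (hcond : ∀ i : Fin m', {l : Fin n | a i l ≠ 0}.ncard ≤ 2) :
    ∃ P : MvPolynomial (Fin n) ℝ, P.totalDegree ≤ 2 ∧
      ∀ x : Fin n → Bool, 0 ≤ eval (binVal x) P ∧
        (eval (binVal x) P = 0 ↔ blpFeasible A b a bl bu x) := by
  classical
  have h1 : ∀ i, ∃ P : MvPolynomial (Fin n) ℝ, P.totalDegree ≤ 2 ∧ ∀ x, eval (binVal x) P =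
      if bl i ≤ ∑ l, a i l * binVal x l ∧ (∑ l, a i l * binVal x l) ≤ bu i then 0 else 1 := by
    intro i
    apply two_var_poly _ (hcond i)
    intro x y hxy
    have : ∑ l, a i l * binVal x l = ∑ l, a i l * binVal y l := by
      refine Finset.sum_congr rfl fun l _ => ?_
      by_cases h : a i l = 0
      · simp [h]
      · simp [binVal, hxy l h]
    simp only [this]
  choose P hP hPe using h1
  choose Q hQ hQe using fun j => lin_poly (A j)
  refine ⟨∑ j, (Q j - C (b j)) ^ 2 + ∑ i, P i, ?_, ?_⟩
  · refine (totalDegree_add _ _).trans (max_le ?_ ?_)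
    · refine totalDegree_finsetSum_le fun j _ => (totalDegree_pow _ _).trans ?_
      have := (totalDegree_sub (Q j) (C (b j))).trans (max_le (hQ j) (by simp))
      omega
    · exact totalDegree_finsetSum_le fun i _ => hP i
  · intro x
    have e : eval (binVal x) (∑ j, (Q j - C (b j)) ^ 2 + ∑ i, P i) =
        ∑ j, (∑ l, A j l * binVal x l - b j) ^ 2 + ∑ i,
        (if bl i ≤ ∑ l, a i l * binVal x l ∧ (∑ l, a i l * binVal x l) ≤ bu i
          then (0 : ℝ) else 1) := by
      simp only [map_add, map_sum, map_pow, map_sub, eval_C, hPe, hQe]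
    rw [e]
    have n1 : ∀ j ∈ Finset.univ, 0 ≤ (∑ l, A j l * binVal x l - b j) ^ 2 :=
      fun j _ => sq_nonneg _
    have n2 : ∀ i ∈ Finset.univ, (0 : ℝ) ≤
        (if bl i ≤ ∑ l, a i l * binVal x l ∧ (∑ l, a i l * binVal x l) ≤ bu i
          then (0 : ℝ) else 1) := fun i _ => by split_ifs <;> norm_num
    have s1 := Finset.sum_nonneg n1
    have s2 := Finset.sum_nonneg n2
    refine ⟨add_nonneg s1 s2, ?_⟩
    rw [add_eq_zero_iff_of_nonneg s1 s2, Finset.sum_eq_zero_iff_of_nonneg n1,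
      Finset.sum_eq_zero_iff_of_nonneg n2, blpFeasible]
    refine and_congr (by simp [sub_eq_zero]) (by simp)

theorem stmt_8 (n m m' : ℕ) (a0 : Fin n → ℝ)
    (A : Fin m → Fin n → ℝ) (b : Fin m → ℝ)
    (a : Fin m' → Fin n → ℝ) (bl bu : Fin m' → ℝ)
    (hb : ∀ i, bl i ≤ bu i)
    (hE : ∃ x : Fin n → Bool, blpFeasible A b a bl bu x)
    (hcond : ∀ i : Fin m', {l : Fin n | a i l ≠ 0}.ncard ≤ 2) :
    ∃ F : MvPolynomial (Fin n) ℝ, F.totalDegree ≤ 2 ∧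
      (∀ x : Fin n → Bool,
        (∀ y : Fin n → Bool,
            MvPolynomial.eval (binVal x) F ≤ MvPolynomial.eval (binVal y) F) ↔
        (blpFeasible A b a bl bu x ∧
          ∀ y : Fin n → Bool, blpFeasible A b a bl bu y →
            (∑ l, a0 l * binVal x l) ≤ ∑ l, a0 l * binVal y l)) ∧
      (∀ x : Fin n → Bool,
        (∀ y : Fin n → Bool,
            MvPolynomial.eval (binVal x) F ≤ MvPolynomial.eval (binVal y) F) →
        MvPolynomial.eval (binVal x) F = ∑ l, a0 l * binVal x l) := by
  obtain ⟨x0, hx0⟩ := hE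
  obtain ⟨V, hVd, hV⟩ := penalty_poly A b a bl bu hcond
  obtain ⟨f, hfd, hf⟩ := lin_poly a0
  simp only [← hf]
  obtain ⟨M, hM⟩ := (Set.finite_range fun x : Fin n → Bool =>
    (MvPolynomial.eval (binVal x0) f - MvPolynomial.eval (binVal x) f) /
      MvPolynomial.eval (binVal x) V).bddAbove
  have hF : ∀ x, MvPolynomial.eval (binVal x) (f + MvPolynomial.C (M + 1) * V) =
      MvPolynomial.eval (binVal x) f + (M + 1) * MvPolynomial.eval (binVal x) V := by
    intro x; simp
  have hfeas : ∀ x, blpFeasible A b a bl bu x →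
      MvPolynomial.eval (binVal x) (f + MvPolynomial.C (M + 1) * V) =
      MvPolynomial.eval (binVal x) f := by
    intro x hx
    rw [hF, ((hV x).2).2 hx]; ring
  have hinf : ∀ x, ¬ blpFeasible A b a bl bu x →
      MvPolynomial.eval (binVal x0) f <
      MvPolynomial.eval (binVal x) (f + MvPolynomial.C (M + 1) * V) := by
    intro x hx
    have hpos : 0 < MvPolynomial.eval (binVal x) V :=
      lt_of_le_of_ne (hV x).1 fun h => hx ((hV x).2.1 h.symm)
    have h := hM (Set.mem_range_self x)
    rw [div_le_iff₀ hpos] at h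
    rw [hF]
    linarith
  have hmin : ∀ x, (∀ y, MvPolynomial.eval (binVal x) (f + MvPolynomial.C (M + 1) * V) ≤
      MvPolynomial.eval (binVal y) (f + MvPolynomial.C (M + 1) * V)) →
      blpFeasible A b a bl bu x := by
    intro x hx
    by_contra hn
    have h1 := hinf x hn
    have h2 := hx x0
    rw [hfeas x0 hx0] at h2
    linarith
  refine ⟨f + MvPolynomial.C (M + 1) * V, ?_, ?_, fun x hx => hfeas x (hmin x hx)⟩
  · refine (MvPolynomial.totalDegree_add _ _).trans (max_le (by omega) ?_)
    refine (MvPolynomial.totalDegree_mul _ _).trans ?_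
    rw [MvPolynomial.totalDegree_C]
    omega
  · intro x
    constructor
    · intro hx
      refine ⟨hmin x hx, fun y hy => ?_⟩
      rw [← hfeas x (hmin x hx), ← hfeas y hy]
      exact hx y
    · rintro ⟨hx, hopt⟩ y
      rw [hfeas x hx]
      by_cases hy : blpFeasible A b a bl bu y
      · rw [hfeas y hy]; exact hopt y hy
      · exact (hopt x0 hx0).trans (hinf y hy).le
end

section
/- Let I⁺ and I⁻ be disjoint finite subsets of {1,…,n} and let j be an integer with −|I⁻| ≤ j ≤ |I⁺| − 1. For x ∈ {0,1}^n define P^j(x) = ∑_{i<i', i,i'∈I⁺} xᵢx_{i'} + ∑_{i<i', i,i'∈I⁻} xᵢx_{i'} − ∑_{i∈I⁺, i'∈I⁻} xᵢx_{i'} − j·∑_{i∈I⁺} xᵢ + (j+1)·∑_{i∈I⁻} xᵢ + j(j+1)/2. Then for every x ∈ {0,1}^n: P^j(x) = 0 if j ≤ ∑_{i∈I⁺} xᵢ − ∑_{i∈I⁻} xᵢ ≤ j+1, and P^j(x) > 0 otherwise. -/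
theorem pair_sum_aux {n : ℕ} (x : Fin n → ℝ) (hx : ∀ i, x i = 0 ∨ x i = 1)
    (s : Finset (Fin n)) :
    (∑ i ∈ s, ∑ i' ∈ s.filter (fun i' => i < i'), x i * x i') =
      ((∑ i ∈ s, x i) ^ 2 - ∑ i ∈ s, x i) / 2 := by
  induction s using Finset.induction_on_max with
  | empty => simp
  | insert a s hs ih =>
    have ha : a ∉ s := fun h => lt_irrefl _ (hs a h)
    rw [Finset.sum_insert ha, Finset.sum_insert ha]
    have h1 : (insert a s).filter (fun i' => a < i') = ∅ := by
      ext b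
      simp only [Finset.mem_filter, Finset.mem_insert, Finset.notMem_empty, iff_false]
      rintro ⟨rfl | hb, h⟩
      · exact lt_irrefl _ h
      · exact lt_asymm h (hs b hb)
    have h2 : ∀ i ∈ s, (∑ i' ∈ (insert a s).filter (fun i' => i < i'), x i * x i') =
        x i * x a + ∑ i' ∈ s.filter (fun i' => i < i'), x i * x i' := by
      intro i hi
      rw [Finset.filter_insert, if_pos (hs i hi), Finset.sum_insert (by simp [ha])]
    rw [h1, Finset.sum_empty, Finset.sum_congr rfl h2, Finset.sum_add_distrib, ih,
      ← Finset.sum_mul]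
    have : x a ^ 2 = x a := by rcases hx a with h | h <;> simp [h]
    linear_combination (-1 / 2) * this

theorem int_sum_aux {n : ℕ} (x : Fin n → ℝ) (hx : ∀ i, x i = 0 ∨ x i = 1)
    (s : Finset (Fin n)) : ∃ k : ℤ, (∑ i ∈ s, x i) = k := by
  have : ∀ i, ∃ k : ℤ, x i = k := fun i => by
    rcases hx i with h | h
    · exact ⟨0, by simp [h]⟩
    · exact ⟨1, by simp [h]⟩
  choose f hf using this
  exact ⟨∑ i ∈ s, f i, by simp [hf]⟩

theorem stmt_9 (n : ℕ) (Ip Im : Finset (Fin n)) (hdisj : Disjoint Ip Im)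
    (j : ℤ) (hjl : -(Im.card : ℤ) ≤ j) (hju : j ≤ (Ip.card : ℤ) - 1)
    (x : Fin n → ℝ) (hx : ∀ i, x i = 0 ∨ x i = 1) :
    (((j : ℝ) ≤ (∑ i ∈ Ip, x i) - ∑ i ∈ Im, x i ∧
      (∑ i ∈ Ip, x i) - ∑ i ∈ Im, x i ≤ (j : ℝ) + 1) →
      (∑ i ∈ Ip, ∑ i' ∈ Ip.filter (fun i' => i < i'), x i * x i') +
      (∑ i ∈ Im, ∑ i' ∈ Im.filter (fun i' => i < i'), x i * x i') -
      (∑ i ∈ Ip, ∑ i' ∈ Im, x i * x i') -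
      (j : ℝ) * (∑ i ∈ Ip, x i) + ((j : ℝ) + 1) * (∑ i ∈ Im, x i) +
      (j : ℝ) * ((j : ℝ) + 1) / 2 = 0) ∧
    (¬ ((j : ℝ) ≤ (∑ i ∈ Ip, x i) - ∑ i ∈ Im, x i ∧
        (∑ i ∈ Ip, x i) - ∑ i ∈ Im, x i ≤ (j : ℝ) + 1) →
      0 < (∑ i ∈ Ip, ∑ i' ∈ Ip.filter (fun i' => i < i'), x i * x i') +
      (∑ i ∈ Im, ∑ i' ∈ Im.filter (fun i' => i < i'), x i * x i') -
      (∑ i ∈ Ip, ∑ i' ∈ Im, x i * x i') -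
      (j : ℝ) * (∑ i ∈ Ip, x i) + ((j : ℝ) + 1) * (∑ i ∈ Im, x i) +
      (j : ℝ) * ((j : ℝ) + 1) / 2) := by
  rw [pair_sum_aux x hx, pair_sum_aux x hx, ← Finset.sum_mul_sum]
  obtain ⟨p, hp⟩ := int_sum_aux x hx Ip
  obtain ⟨m, hm⟩ := int_sum_aux x hx Im
  rw [hp, hm]
  have key : ((p : ℝ) ^ 2 - p) / 2 + ((m : ℝ) ^ 2 - m) / 2 - p * m - j * p + (j + 1) * m
      + j * (j + 1) / 2 = (((p - m - j) * (p - m - j - 1) : ℤ) : ℝ) / 2 := by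
    push_cast; ring
  rw [key]
  have e : ((j : ℝ) ≤ p - m ∧ (p : ℝ) - m ≤ j + 1) ↔ (j ≤ p - m ∧ p - m ≤ j + 1) := by
    norm_cast
  rw [e]
  constructor
  · rintro ⟨h1, h2⟩
    have : p - m - j = 0 ∨ p - m - j - 1 = 0 := by omega
    rw [mul_eq_zero.mpr this]; simp
  · intro h
    have : 0 < (p - m - j) * (p - m - j - 1) := by
      by_cases h1 : j ≤ p - m
      · exact mul_pos (by omega) (by omega)
      · exact mul_pos_of_neg_of_neg (by omega) (by omega)
    have : (0 : ℝ) < (((p - m - j) * (p - m - j - 1) : ℤ) : ℝ) := by exact_mod_cast this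
    exact half_pos this
end

section
/- Let I be a finite subset of {1,…,n} with |I| ≥ 1. For every x ∈ {0,1}^n, the quadratic function P^f(x) = ∑_{i<i', i,i'∈I} xᵢx_{i'} − (|I|−1)·∑_{i∈I} xᵢ + |I|(|I|−1)/2 satisfies: P^f(x) = 0 if ∑_{i∈I} xᵢ ≥ |I| − 1, and P^f(x) > 0 otherwise. Hence P^f is a quadratic valid infeasible penalty for the forcing constraint ∑_{i∈I} xᵢ ≥ |I| − 1. -/
theorem stmt_12 (n : ℕ) (I : Finset (Fin n)) (hI : 1 ≤ I.card)
    (x : Fin n → ℝ) (hx : ∀ i, x i = 0 ∨ x i = 1) :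
    ((((I.card : ℝ) - 1) ≤ ∑ i ∈ I, x i) →
      (∑ i ∈ I, ∑ i' ∈ I.filter (fun i' => i < i'), x i * x i') -
        ((I.card : ℝ) - 1) * (∑ i ∈ I, x i) +
        (I.card : ℝ) * ((I.card : ℝ) - 1) / 2 = 0) ∧
    (¬ (((I.card : ℝ) - 1) ≤ ∑ i ∈ I, x i) →
      0 < (∑ i ∈ I, ∑ i' ∈ I.filter (fun i' => i < i'), x i * x i') -
        ((I.card : ℝ) - 1) * (∑ i ∈ I, x i) +
        (I.card : ℝ) * ((I.card : ℝ) - 1) / 2) := by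
  have hQ : (∑ i ∈ I, x i) * (∑ i ∈ I, x i) =
      2 * (∑ i ∈ I, ∑ i' ∈ I.filter (fun i' => i < i'), x i * x i') + ∑ i ∈ I, x i := by
    have h1 : ∑ i ∈ I, ∑ j ∈ I, (if j < i then x i * x j else 0) =
        ∑ i ∈ I, ∑ j ∈ I, (if i < j then x i * x j else 0) := by
      rw [Finset.sum_comm]
      refine Finset.sum_congr rfl fun i _ => Finset.sum_congr rfl fun j _ => ?_
      rw [mul_comm]
    have h2 : ∑ i ∈ I, x i = ∑ i ∈ I, ∑ j ∈ I, (if i = j then x i * x j else 0) := by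
      refine Finset.sum_congr rfl fun i hi => ?_
      rw [Finset.sum_ite_eq, if_pos hi]
      rcases hx i with h | h <;> simp [h]
    simp only [Finset.sum_filter]
    rw [Finset.sum_mul_sum, two_mul]
    nth_rewrite 1 [← h1]
    rw [h2]
    simp only [← Finset.sum_add_distrib]
    refine Finset.sum_congr rfl fun i _ => Finset.sum_congr rfl fun j _ => ?_
    rcases lt_trichotomy i j with h | h | h
    · simp [h, h.ne, h.not_gt]
    · simp [h]
    · simp [h, h.ne', h.not_gt]
  have hk : ∃ k : ℕ, ∑ i ∈ I, x i = k := by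
    refine ⟨(I.filter (fun i => x i = 1)).card, ?_⟩
    rw [Finset.card_filter]
    push_cast
    refine Finset.sum_congr rfl fun i _ => ?_
    rcases hx i with h | h <;> simp [h]
  have hle : ∑ i ∈ I, x i ≤ I.card := by
    have := Finset.sum_le_card_nsmul I x 1 (fun i _ => by rcases hx i with h | h <;> simp [h])
    simpa using this
  obtain ⟨k, hk⟩ := hk
  rw [hk] at hQ hle ⊢
  constructor
  · intro h
    have h1 : k ≤ I.card := by exact_mod_cast hle
    have h2 : I.card ≤ k + 1 := by
      have : (I.card : ℝ) ≤ k + 1 := by linarith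
      exact_mod_cast this
    have h3 : I.card = k ∨ I.card = k + 1 := by omega
    rcases h3 with h3 | h3
    · rw [h3]; linarith
    · rw [h3]; push_cast; linarith
  · intro h
    push Not at h
    nlinarith [mul_pos (sub_pos.2 h) (by linarith : (0 : ℝ) < I.card - k)]
end
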